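/- arXiv:1911.08014 — 2 statements merged into one kernel-verified Lean document; each statement's English description precedes it below -/
import Mathlib

section
/- For Lagrangians L1, L2, L3 in (ℝ^{2n}, ω), define the (extended) Maslov index μ_n(L1,L2,L3) as the signature of the quadratic form γ on the external direct sum L1 ⊕ L2 ⊕ L3 given by γ(v,w,x) = ω(v,w) + ω(w,x) + ω(x,v). Then: (i) if L1, L2, L3 are pairwise transverse, μ_n(L1,L2,L3) equals the signature of the Maslov form [L1,L2,L3]; (ii) μ_n is Sp(2n,ℝ)-invariant: μ_n(g·L1, g·L2, g·L3) = μ_n(L1,L2,L3) for every g ∈ Sp(2n,ℝ); (iii) μ_n is antisymmetric: for every permutation σ of {1,2,3}, μ_n(L_{σ(1)}, L_{σ(2)}, L_{σ(3)}) = sgn(σ)·μ_n(L1,L2,L3); (iv) the cocycle relation holds: for all Lagrangians L1, L2, L3, L4 one has μ_n(L1,L2,L3) − μ_n(L1,L2,L4) + μ_n(L1,L3,L4) − μ_n(L2,L3,L4) = 0. -/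
open Matrix

noncomputable section

/-- The symplectic vector space `ℝ^{2n}`, with coordinates indexed by `Fin n ⊕ Fin n`. -/
abbrev V2 (n : ℕ) : Type := (Fin n ⊕ Fin n) → ℝ

/-- The standard matrix `J = [[0, Id],[−Id, 0]]`. -/
def Jn (n : ℕ) : Matrix (Fin n ⊕ Fin n) (Fin n ⊕ Fin n) ℝ :=
  Matrix.fromBlocks 0 1 (-1) 0

/-- The standard symplectic form `ω(x,y) = ᵀx J y` on `ℝ^{2n}`. -/
def omegaForm (n : ℕ) (x y : V2 n) : ℝ := x ⬝ᵥ (Jn n).mulVec y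

/-- A subspace is Lagrangian if it has dimension `n` and `ω` vanishes on it. -/
def IsLagrangian (n : ℕ) (L : Submodule ℝ (V2 n)) : Prop :=
  Module.finrank ℝ L = n ∧ ∀ x ∈ L, ∀ y ∈ L, omegaForm n x y = 0

/-- Membership in `Sp(2n,ℝ)`: `ᵀg J g = J`. -/
def IsSymplectic (n : ℕ) (g : Matrix (Fin n ⊕ Fin n) (Fin n ⊕ Fin n) ℝ) : Prop :=
  gᵀ * Jn n * g = Jn n

/-- `φ : L → L'` is the map whose graph is `M`, i.e. `M = {e + φ e : e ∈ L}`. -/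
def IsGraphMap (n : ℕ) (L M L' : Submodule ℝ (V2 n)) (φ : L →ₗ[ℝ] L') : Prop :=
  ∀ x : V2 n, x ∈ M ↔ ∃ e : L, x = (e : V2 n) + (φ e : V2 n)

/-- The largest dimension of a subspace on which `q` is positive definite. -/
def posIndex {V : Type*} [AddCommGroup V] [Module ℝ V] (q : V → ℝ) : ℕ :=
  sSup {d : ℕ | ∃ W : Submodule ℝ V, Module.finrank ℝ W = d ∧ ∀ v ∈ W, v ≠ 0 → 0 < q v}

/-- The signature `p − q` of a quadratic form on a real vector space. -/
def signatureQ {V : Type*} [AddCommGroup V] [Module ℝ V] (q : V → ℝ) : ℤ :=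
  (posIndex q : ℤ) - (posIndex (fun v => -q v) : ℤ)

/-- The (extended) Maslov index of a triple of Lagrangians: the signature of the
quadratic form `γ(v,w,x) = ω(v,w) + ω(w,x) + ω(x,v)` on `L1 ⊕ L2 ⊕ L3`. -/
def maslov (n : ℕ) (L1 L2 L3 : Submodule ℝ (V2 n)) : ℤ :=
  signatureQ (fun p : ↥L1 × ↥L2 × ↥L3 =>
    omegaForm n (p.1 : V2 n) (p.2.1 : V2 n) + omegaForm n (p.2.1 : V2 n) (p.2.2 : V2 n) +
      omegaForm n (p.2.2 : V2 n) (p.1 : V2 n))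

section Signature

variable {V W : Type*} [AddCommGroup V] [Module ℝ V] [AddCommGroup W] [Module ℝ W]

theorem posIndex_comp_linearEquiv (e : V ≃ₗ[ℝ] W) (q : W → ℝ) :
    posIndex (fun v => q (e v)) = posIndex q := by
  unfold posIndex
  congr 1
  ext d
  constructor
  · rintro ⟨U, rfl, hU⟩
    refine ⟨U.map e.toLinearMap, e.finrank_map_eq U, ?_⟩
    rintro _ ⟨v, hv, rfl⟩ hne
    exact hU v hv fun h => hne (by simp [h])
  · rintro ⟨U, rfl, hU⟩
    refine ⟨U.map e.symm.toLinearMap, e.symm.finrank_map_eq U, ?_⟩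
    rintro _ ⟨v, hv, rfl⟩ hne
    simpa using hU v hv fun h => hne (by simp [h])

theorem signatureQ_comp_linearEquiv (e : V ≃ₗ[ℝ] W) (q : W → ℝ) :
    signatureQ (fun v => q (e v)) = signatureQ q := by
  unfold signatureQ
  rw [posIndex_comp_linearEquiv e q, posIndex_comp_linearEquiv e fun w => -q w]

theorem signatureQ_neg (q : V → ℝ) : signatureQ (fun v => -q v) = -signatureQ q := by
  simp [signatureQ]

theorem signatureQ_const_mul {c : ℝ} (hc : 0 < c) (q : V → ℝ) :
    signatureQ (fun v => c * q v) = signatureQ q := by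
  simp only [signatureQ, posIndex, ← mul_neg, mul_pos_iff_of_pos_left hc]

theorem posIndex_eq_sigPos [FiniteDimensional ℝ V] (Q : QuadraticForm ℝ V) :
    posIndex Q = sigPos Q := by
  have h := (sigPos_isGreatest Q).csSup_eq
  simpa [QuadraticMap.PosDef, posIndex] using h

theorem signatureQ_eq_sigPos_sub_sigNeg [FiniteDimensional ℝ V] (Q : QuadraticForm ℝ V) :
    signatureQ Q = (sigPos Q : ℤ) - sigNeg Q := by
  rw [signatureQ, posIndex_eq_sigPos, ← sigPos_neg, ← posIndex_eq_sigPos (-Q)]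
  rfl

theorem Submodule.finrank_prod [FiniteDimensional ℝ V] [FiniteDimensional ℝ W]
    (U : Submodule ℝ V) (T : Submodule ℝ W) :
    Module.finrank ℝ (U.prod T) = Module.finrank ℝ U + Module.finrank ℝ T := by
  have h := LinearMap.finrank_range_of_inj (f := U.subtype.prodMap T.subtype)
    (Function.Injective.prodMap U.injective_subtype T.injective_subtype)
  rwa [LinearMap.range_prodMap, U.range_subtype, T.range_subtype, Module.finrank_prod] at h

theorem sigPos_add_le_sigPos_prod [FiniteDimensional ℝ V] [FiniteDimensional ℝ W]
    (Q : QuadraticForm ℝ V) (R : QuadraticForm ℝ W) :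
    sigPos Q + sigPos R ≤ sigPos (Q.prod R) := by
  obtain ⟨U, hU, hQ⟩ := exists_finrank_eq_sigPos_and_posDef Q
  obtain ⟨T, hT, hR⟩ := exists_finrank_eq_sigPos_and_posDef R
  rw [← hU, ← hT, ← Submodule.finrank_prod]
  refine le_sigPos_of_posDef _ ?_
  rintro ⟨⟨u, t⟩, hu, ht⟩ hne
  exact hQ.prod hR (⟨u, hu⟩, ⟨t, ht⟩) fun h => hne (Subtype.ext (by simpa using h))

theorem signatureQ_prod [FiniteDimensional ℝ V] [FiniteDimensional ℝ W]
    (Q : QuadraticForm ℝ V) (R : QuadraticForm ℝ W) :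
    signatureQ (Q.prod R) = signatureQ Q + signatureQ R := by
  have hpos := sigPos_add_le_sigPos_prod Q R
  have hneg : sigNeg Q + sigNeg R ≤ sigNeg (Q.prod R) := by
    have h : -(Q.prod R) = (-Q).prod (-R) := by
      ext x
      simp [add_comm]
    simpa only [← h, sigPos_neg] using sigPos_add_le_sigPos_prod (-Q) (-R)
  have hrad : Module.finrank ℝ Q.radical + Module.finrank ℝ R.radical ≤
      Module.finrank ℝ (Q.prod R).radical := by
    rw [← Submodule.finrank_prod]
    refine Submodule.finrank_mono fun x hx => ?_
    obtain ⟨h₁, h₂⟩ := hx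
    simp_all [QuadraticMap.mem_radical_iff']
  have hQ := QuadraticForm.sigPos_add_sigNeg_add_radical (Q := Q)
  have hR := QuadraticForm.sigPos_add_sigNeg_add_radical (Q := R)
  have hQR := QuadraticForm.sigPos_add_sigNeg_add_radical (Q := Q.prod R)
  rw [Module.finrank_prod] at hQR
  simp only [signatureQ_eq_sigPos_sub_sigNeg]
  omega

/-- The signature of the direct sum of three symmetric bilinear forms is additive. -/
theorem signatureQ_diagonal [FiniteDimensional ℝ V] (B₁ B₂ B₃ : LinearMap.BilinForm ℝ V) :
    signatureQ (fun p : V × V × V =>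
        B₁ p.1 p.1 + (B₂ p.2.1 p.2.1 + B₃ p.2.2 p.2.2)) =
      signatureQ (fun v => B₁ v v) + signatureQ (fun v => B₂ v v) +
        signatureQ (fun v => B₃ v v) := by
  have h := signatureQ_prod B₁.toQuadraticMap (B₂.toQuadraticMap.prod B₃.toQuadraticMap)
  rw [signatureQ_prod B₂.toQuadraticMap, ← add_assoc] at h
  exact h

theorem signatureQ_cyclic_of_sum_eq_zero [FiniteDimensional ℝ V]
    {B₁ B₂ B₃ : LinearMap.BilinForm ℝ V} (h₁ : B₁.IsSymm) (h₂ : B₂.IsSymm) (h₃ : B₃.IsSymm)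
    (h : ∀ v w, B₁ v w + B₂ v w + B₃ v w = 0) :
    signatureQ (fun p : V × V × V => B₁ p.1 p.2.1 + B₂ p.2.1 p.2.2 + B₃ p.2.2 p.1) =
      signatureQ (fun v => B₁ v v) + signatureQ (fun v => B₂ v v) +
        signatureQ (fun v => B₃ v v) := by
  let e : (V × V × V) ≃ₗ[ℝ] (V × V × V) :=
    { toFun := fun p => (p.1 + p.2.1 - p.2.2, p.2.1 + p.2.2 - p.1, p.2.2 + p.1 - p.2.1)
      invFun := fun p => ((2⁻¹ : ℝ) • (p.1 + p.2.2), (2⁻¹ : ℝ) • (p.1 + p.2.1),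
        (2⁻¹ : ℝ) • (p.2.1 + p.2.2))
      map_add' := fun p r => by ext <;> simp <;> abel
      map_smul' := fun c p => by ext <;> simp <;> module
      left_inv := fun p => by ext <;> simp <;> module
      right_inv := fun p => by ext <;> simp <;> module }
  rw [← signatureQ_diagonal, ← signatureQ_comp_linearEquiv e
    (fun p : V × V × V => B₁ p.1 p.1 + (B₂ p.2.1 p.2.1 + B₃ p.2.2 p.2.2)),
    ← signatureQ_const_mul (c := 4) (by norm_num)]
  congr 1
  ext ⟨x, y, z⟩
  simp only [e, LinearEquiv.coe_mk, LinearMap.coe_mk, AddHom.coe_mk, map_add, map_sub,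
    LinearMap.add_apply, LinearMap.sub_apply]
  have s₁ := h₁.eq
  have s₂ := h₂.eq
  have s₃ := h₃.eq
  rw [s₁ y x, s₁ z x, s₁ z y, s₂ y x, s₂ z x, s₂ z y, s₃ y x, s₃ z x, s₃ z y]
  linear_combination 2 * h x y + 2 * h y z + 2 * h x z - h x x - h y y - h z z

theorem signatureQ_sub_of_isSymm [FiniteDimensional ℝ V]
    {B : LinearMap.BilinForm ℝ V} (hB : B.IsSymm) :
    signatureQ (fun p : V × V × V => B p.1 p.2.1 + B p.2.1 p.2.2 - B p.1 p.2.2) =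
      signatureQ (fun v => B v v) := by
  let e : (V × V × V) ≃ₗ[ℝ] (V × V × V) :=
    { toFun := fun p => (p.2.1, p.2.1 - (2⁻¹ : ℝ) • (p.1 + p.2.2), (2⁻¹ : ℝ) • (p.1 - p.2.2))
      invFun := fun p => (p.1 - p.2.1 + p.2.2, p.1, p.1 - p.2.1 - p.2.2)
      map_add' := fun p r => by ext <;> simp <;> module
      map_smul' := fun c p => by ext <;> simp <;> module
      left_inv := fun p => by ext <;> simp; all_goals module
      right_inv := fun p => by ext <;> simp; all_goals module }
  have h := signatureQ_diagonal B (-B) B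
  simp only [LinearMap.neg_apply, signatureQ_neg, add_neg_cancel, zero_add] at h
  rw [← h, ← signatureQ_comp_linearEquiv e
    (fun p : V × V × V => B p.1 p.1 + (-B p.2.1 p.2.1 + B p.2.2 p.2.2))]
  congr 1
  ext ⟨x, y, z⟩
  have s := hB.eq
  simp only [e, LinearEquiv.coe_mk, LinearMap.coe_mk, AddHom.coe_mk, map_add, map_sub, map_smul,
    LinearMap.add_apply, LinearMap.sub_apply, LinearMap.smul_apply, smul_eq_mul]
  rw [s y x, s z x, s z y]
  ring

end Signature

section Symplectic

variable {n : ℕ}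

/-- The standard symplectic form as a bundled bilinear form. -/
def omegaBilin (n : ℕ) : LinearMap.BilinForm ℝ (V2 n) := Matrix.toBilin' (Jn n)

theorem omegaForm_eq_omegaBilin (x y : V2 n) : omegaForm n x y = omegaBilin n x y :=
  (Matrix.toBilin'_apply' _ _ _).symm

theorem Jn_eq_neg_J (n : ℕ) : Jn n = -Matrix.J (Fin n) ℝ := by
  simp [Jn, Matrix.J, Matrix.fromBlocks_neg]

theorem omegaBilin_swap (x y : V2 n) : omegaBilin n x y = -omegaBilin n y x := by
  have h : (Jn n)ᵀ = -Jn n := by simp [Jn_eq_neg_J]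
  simp only [← omegaForm_eq_omegaBilin, omegaForm]
  rw [dotProduct_comm, ← dotProduct_transpose_mulVec, h, neg_mulVec, dotProduct_neg, neg_neg, dotProduct_comm]

theorem omegaBilin_isAlt : (omegaBilin n).IsAlt := fun x => by
  have := omegaBilin_swap x x
  linarith

theorem det_Jn_ne_zero (n : ℕ) : (Jn n).det ≠ 0 := by
  rw [Jn_eq_neg_J, Matrix.det_neg]
  exact mul_ne_zero (pow_ne_zero _ (by norm_num)) (Matrix.isUnit_det_J _ _).ne_zero

theorem omegaBilin_nondegenerate (n : ℕ) : (omegaBilin n).Nondegenerate :=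
  LinearMap.BilinForm.nondegenerate_toBilin'_of_det_ne_zero' _ (det_Jn_ne_zero n)

theorem finrank_V2 (n : ℕ) : Module.finrank ℝ (V2 n) = n + n := by
  simp

/-- A non-maximal isotropic subspace `M` transverse to a Lagrangian `L` has an orthogonal
complement which is not contained in `M ⊔ L`. -/
theorem not_orthogonal_le_sup {M L : Submodule ℝ (V2 n)} (hL : IsLagrangian n L)
    (hM : Module.finrank ℝ M < n) (hdisj : Disjoint M L) :
    ¬ (omegaBilin n).orthogonal M ≤ M ⊔ L := by
  intro hle
  have hrefl : (omegaBilin n).IsRefl := omegaBilin_isAlt.isRefl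
  have hrank := LinearMap.BilinForm.finrank_orthogonal (omegaBilin_nondegenerate n) M
  have hsum := Submodule.finrank_sup_add_finrank_inf_eq ((omegaBilin n).orthogonal M) L
  have htop := Submodule.finrank_le ((omegaBilin n).orthogonal M ⊔ L)
  rw [finrank_V2] at hrank htop
  rw [hL.1] at hsum
  have hne : (omegaBilin n).orthogonal M ⊓ L ≠ ⊥ := by
    intro h
    rw [h, finrank_bot] at hsum
    omega
  obtain ⟨y, ⟨hyM, hyL⟩, hy0⟩ := Submodule.exists_mem_ne_zero_of_ne_bot hne
  have hy : y ∈ (omegaBilin n).orthogonal ((omegaBilin n).orthogonal M) := by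
    intro z hz
    obtain ⟨m, hm, l, hl, rfl⟩ := Submodule.mem_sup.1 (hle hz)
    have h₁ : omegaBilin n m y = 0 := hyM m hm
    have h₂ : omegaBilin n l y = 0 := by rw [← omegaForm_eq_omegaBilin]; exact hL.2 l hl y hyL
    simp [h₁, h₂]
  rw [LinearMap.BilinForm.orthogonal_orthogonal (omegaBilin_nondegenerate n) hrefl] at hy
  exact hy0 (Submodule.disjoint_def.1 hdisj y hy hyL)

/-- Finitely many Lagrangians admit a common transverse isotropic subspace of any
dimension `k ≤ n`. -/
theorem exists_isotropic_disjoint {ι : Type*} [Finite ι] [Nonempty ι]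
    {L : ι → Submodule ℝ (V2 n)} (hL : ∀ i, IsLagrangian n (L i)) (k : ℕ) (hk : k ≤ n) :
    ∃ M : Submodule ℝ (V2 n), Module.finrank ℝ M = k ∧
      (∀ x ∈ M, ∀ y ∈ M, omegaBilin n x y = 0) ∧ ∀ i, Disjoint M (L i) := by
  induction k with
  | zero => exact ⟨⊥, finrank_bot _ _, by simp, fun i => disjoint_bot_left⟩
  | succ k ih =>
    obtain ⟨M, hrank, hiso, hdisj⟩ := ih (by omega)
    obtain ⟨v, hvM, hvL⟩ : ∃ v ∈ (omegaBilin n).orthogonal M, ∀ i, v ∉ M ⊔ L i := by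
      by_contra! hcover
      obtain ⟨i, hi⟩ := Subspace.exists_eq_top_of_iUnion_eq_univ
        (p := fun i => (M ⊔ L i).comap ((omegaBilin n).orthogonal M).subtype)
        (Set.eq_univ_of_forall fun v => by simpa using hcover v v.2)
      exact not_orthogonal_le_sup (hL i) (by omega) (hdisj i)
        (Submodule.comap_subtype_eq_top.1 hi)
    have hv : ∀ m ∈ M, omegaBilin n m v = 0 := hvM
    have hv' : ∀ m ∈ M, omegaBilin n v m = 0 := fun m hm => by
      rw [omegaBilin_swap, hv m hm, neg_zero]
    obtain ⟨i₀⟩ := ‹Nonempty ι›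
    refine ⟨M ⊔ Submodule.span ℝ {v}, ?_, ?_, fun i => ?_⟩
    · rw [Submodule.finrank_sup_span_singleton fun h => hvL i₀ (Submodule.mem_sup_left h), hrank]
    · simp only [Submodule.mem_sup, Submodule.mem_span_singleton]
      rintro _ ⟨x, hx, _, ⟨a, rfl⟩, rfl⟩ _ ⟨y, hy, _, ⟨b, rfl⟩, rfl⟩
      simp [hiso x hx y hy, hv x hx, hv' y hy, omegaBilin_isAlt.self_eq_zero v]
    · rw [Submodule.disjoint_def]
      intro x hx hxL
      simp only [Submodule.mem_sup, Submodule.mem_span_singleton] at hx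
      obtain ⟨m, hm, _, ⟨a, rfl⟩, rfl⟩ := hx
      have ha : a = 0 := by
        by_contra ha
        refine hvL i ((Submodule.smul_mem_iff _ ha).1 ?_)
        have := Submodule.sub_mem _ (Submodule.mem_sup_right (S := M) hxL)
          (Submodule.mem_sup_left (T := L i) hm)
        simpa using this
      subst ha
      simp only [zero_smul, add_zero] at hxL ⊢
      exact Submodule.disjoint_def.1 (hdisj i) m hm hxL

theorem exists_isotropic_isCompl {ι : Type*} [Finite ι] [Nonempty ι]
    {L : ι → Submodule ℝ (V2 n)} (hL : ∀ i, IsLagrangian n (L i)) :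
    ∃ M : Submodule ℝ (V2 n), (∀ x ∈ M, ∀ y ∈ M, omegaBilin n x y = 0) ∧
      ∀ i, IsCompl M (L i) := by
  obtain ⟨M, hrank, hiso, hdisj⟩ := exists_isotropic_disjoint hL n le_rfl
  refine ⟨M, hiso, fun i => (Submodule.isCompl_iff_disjoint _ _ ?_).2 (hdisj i)⟩
  rw [finrank_V2, hrank, (hL i).1]

/-- The linear section of `V → V ⧸ M` with image a complement `L` of `M`. -/
def sectionOfIsCompl {M L : Submodule ℝ (V2 n)} (h : IsCompl M L) : (V2 n ⧸ M) →ₗ[ℝ] V2 n :=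
  L.subtype ∘ₗ (M.quotientEquivOfIsCompl L h).toLinearMap

theorem sectionOfIsCompl_mem {M L : Submodule ℝ (V2 n)} (h : IsCompl M L) (x : V2 n ⧸ M) :
    sectionOfIsCompl h x ∈ L :=
  (M.quotientEquivOfIsCompl L h x).2

theorem sectionOfIsCompl_sub_mem {M L L' : Submodule ℝ (V2 n)} (h : IsCompl M L)
    (h' : IsCompl M L') (x : V2 n ⧸ M) : sectionOfIsCompl h' x - sectionOfIsCompl h x ∈ M := by
  rw [← Submodule.Quotient.eq]
  exact (Submodule.mk_quotientEquivOfIsCompl_apply h' x).trans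
    (Submodule.mk_quotientEquivOfIsCompl_apply h x).symm

/-- The difference of two complements `L`, `L'` of `M`, seen as a bilinear form on `V ⧸ M`. -/
def relativeForm {M L L' : Submodule ℝ (V2 n)} (h : IsCompl M L) (h' : IsCompl M L') :
    LinearMap.BilinForm ℝ (V2 n ⧸ M) :=
  (omegaBilin n).compl₁₂ (sectionOfIsCompl h) (sectionOfIsCompl h')

theorem relativeForm_apply {M L L' : Submodule ℝ (V2 n)} (h : IsCompl M L) (h' : IsCompl M L')
    (x y : V2 n ⧸ M) :
    relativeForm h h' x y = omegaBilin n (sectionOfIsCompl h x) (sectionOfIsCompl h' y) :=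
  rfl

theorem omegaBilin_eq_zero {L : Submodule ℝ (V2 n)} (hL : IsLagrangian n L) {x y : V2 n}
    (hx : x ∈ L) (hy : y ∈ L) : omegaBilin n x y = 0 := by
  rw [← omegaForm_eq_omegaBilin]
  exact hL.2 x hx y hy

theorem relativeForm_isSymm {M L L' : Submodule ℝ (V2 n)}
    (hM : ∀ x ∈ M, ∀ y ∈ M, omegaBilin n x y = 0) (hL : IsLagrangian n L)
    (hL' : IsLagrangian n L') (h : IsCompl M L) (h' : IsCompl M L') :
    (relativeForm h h').IsSymm := by
  refine ⟨fun x y => ?_⟩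
  have h₁ := hM _ (sectionOfIsCompl_sub_mem h h' x) _ (sectionOfIsCompl_sub_mem h h' y)
  have h₂ := omegaBilin_eq_zero hL (sectionOfIsCompl_mem h x) (sectionOfIsCompl_mem h y)
  have h₃ := omegaBilin_eq_zero hL' (sectionOfIsCompl_mem h' x) (sectionOfIsCompl_mem h' y)
  have h₄ := omegaBilin_swap (sectionOfIsCompl h' x) (sectionOfIsCompl h y)
  simp only [map_sub, LinearMap.sub_apply] at h₁
  simp only [relativeForm_apply]
  linarith

theorem signatureQ_relativeForm_swap {M L L' : Submodule ℝ (V2 n)}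
    (h : IsCompl M L) (h' : IsCompl M L') :
    signatureQ (fun x => relativeForm h' h x x) = -signatureQ (fun x => relativeForm h h' x x) := by
  rw [← signatureQ_neg]
  congr 1
  ext x
  exact omegaBilin_swap _ _

/-- The Maslov index in terms of an isotropic common complement. -/
theorem maslov_eq_sum_relativeForm {M L₁ L₂ L₃ : Submodule ℝ (V2 n)}
    (hM : ∀ x ∈ M, ∀ y ∈ M, omegaBilin n x y = 0) (hL₁ : IsLagrangian n L₁)
    (hL₂ : IsLagrangian n L₂) (hL₃ : IsLagrangian n L₃)
    (h₁ : IsCompl M L₁) (h₂ : IsCompl M L₂) (h₃ : IsCompl M L₃) :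
    maslov n L₁ L₂ L₃ = signatureQ (fun x => relativeForm h₁ h₂ x x) +
      signatureQ (fun x => relativeForm h₂ h₃ x x) +
      signatureQ (fun x => relativeForm h₃ h₁ x x) := by
  rw [← signatureQ_cyclic_of_sum_eq_zero (relativeForm_isSymm hM hL₁ hL₂ h₁ h₂)
    (relativeForm_isSymm hM hL₂ hL₃ h₂ h₃) (relativeForm_isSymm hM hL₃ hL₁ h₃ h₁)]
  · rw [maslov, ← signatureQ_comp_linearEquiv ((M.quotientEquivOfIsCompl L₁ h₁).prodCongr
      ((M.quotientEquivOfIsCompl L₂ h₂).prodCongr (M.quotientEquivOfIsCompl L₃ h₃)))]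
    simp only [omegaForm_eq_omegaBilin]
    rfl
  · intro x y
    have e₁ := omegaBilin_eq_zero hL₁ (sectionOfIsCompl_mem h₁ x) (sectionOfIsCompl_mem h₁ y)
    have e₂ := omegaBilin_eq_zero hL₂ (sectionOfIsCompl_mem h₂ x) (sectionOfIsCompl_mem h₂ y)
    have e₃ := omegaBilin_eq_zero hL₃ (sectionOfIsCompl_mem h₃ x) (sectionOfIsCompl_mem h₃ y)
    have e₄ := hM _ (sectionOfIsCompl_sub_mem h₁ h₂ x) _ (sectionOfIsCompl_sub_mem h₂ h₃ y)
    have e₅ := hM _ (sectionOfIsCompl_sub_mem h₁ h₃ x) _ (sectionOfIsCompl_sub_mem h₃ h₁ y)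
    simp only [map_sub, LinearMap.sub_apply] at e₄ e₅
    simp only [relativeForm_apply]
    linarith

theorem maslov_cocycle {L₁ L₂ L₃ L₄ : Submodule ℝ (V2 n)} (hL₁ : IsLagrangian n L₁)
    (hL₂ : IsLagrangian n L₂) (hL₃ : IsLagrangian n L₃) (hL₄ : IsLagrangian n L₄) :
    maslov n L₁ L₂ L₃ - maslov n L₁ L₂ L₄ + maslov n L₁ L₃ L₄ - maslov n L₂ L₃ L₄ = 0 := by
  obtain ⟨M, hM, h⟩ := exists_isotropic_isCompl (L := ![L₁, L₂, L₃, L₄])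
    (by simp [Fin.forall_fin_succ, *])
  have h₁ : IsCompl M L₁ := h 0
  have h₂ : IsCompl M L₂ := h 1
  have h₃ : IsCompl M L₃ := h 2
  have h₄ : IsCompl M L₄ := h 3
  rw [maslov_eq_sum_relativeForm hM hL₁ hL₂ hL₃ h₁ h₂ h₃,
    maslov_eq_sum_relativeForm hM hL₁ hL₂ hL₄ h₁ h₂ h₄,
    maslov_eq_sum_relativeForm hM hL₁ hL₃ hL₄ h₁ h₃ h₄,
    maslov_eq_sum_relativeForm hM hL₂ hL₃ hL₄ h₂ h₃ h₄,
    signatureQ_relativeForm_swap h₁ h₃, signatureQ_relativeForm_swap h₂ h₄]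
  ring

theorem maslov_rotate (L₁ L₂ L₃ : Submodule ℝ (V2 n)) :
    maslov n L₂ L₃ L₁ = maslov n L₁ L₂ L₃ := by
  unfold maslov
  rw [← signatureQ_comp_linearEquiv
    ((LinearEquiv.prodComm ℝ L₁ (L₂ × L₃)).trans (LinearEquiv.prodAssoc ℝ L₂ L₃ L₁))]
  congr 1
  ext p
  exact add_rotate _ _ _ |>.symm

theorem maslov_swap_left (L₁ L₂ L₃ : Submodule ℝ (V2 n)) :
    maslov n L₂ L₁ L₃ = -maslov n L₁ L₂ L₃ := by
  unfold maslov
  let e : (L₁ × L₂ × L₃) ≃ₗ[ℝ] (L₂ × L₁ × L₃) :=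
    (LinearEquiv.prodAssoc ℝ L₁ L₂ L₃).symm.trans
      (((LinearEquiv.prodComm ℝ L₁ L₂).prodCongr (LinearEquiv.refl ℝ L₃)).trans
        (LinearEquiv.prodAssoc ℝ L₂ L₁ L₃))
  rw [← signatureQ_neg, ← signatureQ_comp_linearEquiv e]
  congr 1
  ext ⟨x, y, z⟩
  simp only [omegaForm_eq_omegaBilin]
  change omegaBilin n y x + omegaBilin n x z + omegaBilin n z y = _
  rw [omegaBilin_swap (y : V2 n) x, omegaBilin_swap (x : V2 n) z, omegaBilin_swap (z : V2 n) y]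
  ring

theorem maslov_perm (L : Fin 3 → Submodule ℝ (V2 n)) (σ : Equiv.Perm (Fin 3)) :
    maslov n (L (σ 0)) (L (σ 1)) (L (σ 2)) =
      ((Equiv.Perm.sign σ : ℤˣ) : ℤ) * maslov n (L 0) (L 1) (L 2) := by
  induction σ using Equiv.Perm.swap_induction_on generalizing L with
  | one => simp
  | swap_mul f x y hxy ih =>
    have h₁ : maslov n (L 1) (L 0) (L 2) = -maslov n (L 0) (L 1) (L 2) := maslov_swap_left _ _ _
    have h₂ : maslov n (L 0) (L 2) (L 1) = -maslov n (L 0) (L 1) (L 2) := by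
      rw [← maslov_rotate, maslov_swap_left, maslov_rotate]
    have h₃ : maslov n (L 2) (L 1) (L 0) = -maslov n (L 0) (L 1) (L 2) := by
      rw [maslov_swap_left, maslov_rotate]
    have hswap : maslov n (L (Equiv.swap x y 0)) (L (Equiv.swap x y 1)) (L (Equiv.swap x y 2)) =
        -maslov n (L 0) (L 1) (L 2) := by
      fin_cases x <;> fin_cases y <;> simp_all [Equiv.swap_apply_def]
    have h := ih (L ∘ Equiv.swap x y)
    simp only [Function.comp_apply, hswap] at h
    simp [h, Equiv.Perm.sign_swap hxy]

theorem omegaForm_mulVec {g : Matrix (Fin n ⊕ Fin n) (Fin n ⊕ Fin n) ℝ} (hg : IsSymplectic n g)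
    (x y : V2 n) : omegaForm n (g.mulVec x) (g.mulVec y) = omegaForm n x y := by
  have h : gᵀ * Jn n * g = Jn n := hg
  simp only [omegaForm]
  conv_rhs => rw [← h]
  rw [← mulVec_mulVec, ← mulVec_mulVec, dotProduct_mulVec x, vecMul_transpose]

theorem mulVecLin_injective_of_isSymplectic {g : Matrix (Fin n ⊕ Fin n) (Fin n ⊕ Fin n) ℝ}
    (hg : IsSymplectic n g) : Function.Injective g.mulVecLin := by
  have h : gᵀ * Jn n * g = Jn n := hg
  refine Matrix.mulVec_injective_of_isUnit ((Matrix.isUnit_iff_isUnit_det g).2 ?_)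
  refine isUnit_iff_ne_zero.2 fun h0 => det_Jn_ne_zero n ?_
  rw [← h, Matrix.det_mul, h0, mul_zero]

theorem maslov_map_of_isSymplectic {g : Matrix (Fin n ⊕ Fin n) (Fin n ⊕ Fin n) ℝ}
    (hg : IsSymplectic n g) (L₁ L₂ L₃ : Submodule ℝ (V2 n)) :
    maslov n (L₁.map g.mulVecLin) (L₂.map g.mulVecLin) (L₃.map g.mulVecLin) =
      maslov n L₁ L₂ L₃ := by
  have hinj := mulVecLin_injective_of_isSymplectic hg
  unfold maslov
  rw [← signatureQ_comp_linearEquiv ((L₁.equivMapOfInjective _ hinj).prodCongr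
    ((L₂.equivMapOfInjective _ hinj).prodCongr (L₃.equivMapOfInjective _ hinj)))]
  congr 1
  ext p
  simp [omegaForm_mulVec hg]

theorem maslov_eq_signatureQ_of_isGraphMap {L₁ L₂ L₃ : Submodule ℝ (V2 n)}
    (hL₁ : IsLagrangian n L₁) (hL₂ : IsLagrangian n L₂) (hL₃ : IsLagrangian n L₃)
    (h₁₂ : L₁ ⊓ L₂ = ⊥) (h₁₃ : L₁ ⊓ L₃ = ⊥) {φ : L₁ →ₗ[ℝ] L₃} (hφ : IsGraphMap n L₁ L₂ L₃ φ) :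
    maslov n L₁ L₂ L₃ = signatureQ (fun v : L₁ => omegaForm n (v : V2 n) (φ v : V2 n)) := by
  have hmem : ∀ v : L₁, (v : V2 n) + φ v ∈ L₂ := fun v => (hφ _).2 ⟨v, rfl⟩
  have hφinj : Function.Injective φ := by
    rw [injective_iff_map_eq_zero]
    intro v hv
    have h : (v : V2 n) ∈ L₁ ⊓ L₂ := ⟨v.2, by simpa [hv] using hmem v⟩
    simpa [h₁₂] using h
  let e₃ : L₁ ≃ₗ[ℝ] L₃ := φ.linearEquivOfInjective hφinj (hL₁.1.trans hL₃.1.symm)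
  let γ : L₁ →ₗ[ℝ] L₂ := (L₁.subtype + L₃.subtype ∘ₗ φ).codRestrict L₂ hmem
  have hγ : Function.Bijective γ := by
    constructor
    · rw [injective_iff_map_eq_zero]
      intro v hv
      have hv' : (v : V2 n) + φ v = 0 := congrArg Subtype.val hv
      have h : (v : V2 n) ∈ L₁ ⊓ L₃ :=
        ⟨v.2, by rw [eq_neg_of_add_eq_zero_left hv']; exact neg_mem (φ v).2⟩
      simpa [h₁₃] using h
    · rintro ⟨x, hx⟩
      obtain ⟨v, rfl⟩ := (hφ x).1 hx
      exact ⟨v, rfl⟩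
  let B : LinearMap.BilinForm ℝ L₁ := (omegaBilin n).compl₁₂ L₁.subtype (L₃.subtype ∘ₗ φ)
  have hB : ∀ v w, B v w = omegaBilin n v (φ w) := fun _ _ => rfl
  have hsymm : B.IsSymm := by
    refine ⟨fun v w => ?_⟩
    have e₁ := omegaBilin_eq_zero hL₂ (hmem v) (hmem w)
    have e₂ := omegaBilin_eq_zero hL₁ v.2 w.2
    have e₃ := omegaBilin_eq_zero hL₃ (φ v).2 (φ w).2
    have e₄ := omegaBilin_swap (φ v : V2 n) w
    simp only [map_add, LinearMap.add_apply] at e₁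
    simp only [hB]
    linarith
  have hsig := signatureQ_sub_of_isSymm hsymm
  simp only [hB, ← omegaForm_eq_omegaBilin] at hsig
  rw [← hsig, maslov, ← signatureQ_comp_linearEquiv
    ((LinearEquiv.refl ℝ L₁).prodCongr ((LinearEquiv.ofBijective γ hγ).prodCongr e₃))]
  congr 1
  ext ⟨v, w, x⟩
  simp only [omegaForm_eq_omegaBilin]
  change omegaBilin n v ((w : V2 n) + φ w) + omegaBilin n ((w : V2 n) + φ w) (φ x) +
    omegaBilin n (φ x) v = _
  have e₁ := omegaBilin_eq_zero hL₁ v.2 w.2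
  have e₂ := omegaBilin_eq_zero hL₃ (φ w).2 (φ x).2
  have e₃ := omegaBilin_swap (φ x : V2 n) v
  simp only [map_add, LinearMap.add_apply]
  linarith

end Symplectic

theorem maslov_index_properties (n : ℕ) :
    -- (i) on pairwise transverse triples, `maslov` is the signature of the Maslov form
    (∀ L1 L2 L3 : Submodule ℝ (V2 n),
      IsLagrangian n L1 → IsLagrangian n L2 → IsLagrangian n L3 →
      L1 ⊓ L2 = ⊥ → L2 ⊓ L3 = ⊥ → L1 ⊓ L3 = ⊥ →
      ∀ φ : L1 →ₗ[ℝ] L3, IsGraphMap n L1 L2 L3 φ →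
        maslov n L1 L2 L3 = signatureQ (fun v : ↥L1 => omegaForm n (v : V2 n) (φ v : V2 n))) ∧
    -- (ii) invariance under `Sp(2n,ℝ)`
    (∀ L1 L2 L3 : Submodule ℝ (V2 n),
      IsLagrangian n L1 → IsLagrangian n L2 → IsLagrangian n L3 →
      ∀ g, IsSymplectic n g →
        maslov n (L1.map g.mulVecLin) (L2.map g.mulVecLin) (L3.map g.mulVecLin) =
          maslov n L1 L2 L3) ∧
    -- (iii) antisymmetry
    (∀ L : Fin 3 → Submodule ℝ (V2 n), (∀ i, IsLagrangian n (L i)) →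
      ∀ σ : Equiv.Perm (Fin 3),
        maslov n (L (σ 0)) (L (σ 1)) (L (σ 2)) =
          ((Equiv.Perm.sign σ : ℤˣ) : ℤ) * maslov n (L 0) (L 1) (L 2)) ∧
    -- (iv) cocycle relation
    (∀ L1 L2 L3 L4 : Submodule ℝ (V2 n),
      IsLagrangian n L1 → IsLagrangian n L2 → IsLagrangian n L3 → IsLagrangian n L4 →
      maslov n L1 L2 L3 - maslov n L1 L2 L4 + maslov n L1 L3 L4 - maslov n L2 L3 L4 = 0) := by
  refine ⟨?_, ?_, fun L _ σ => maslov_perm L σ, ?_⟩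
  · intro L1 L2 L3 h1 h2 h3 h12 _ h13 φ hφ
    exact maslov_eq_signatureQ_of_isGraphMap h1 h2 h3 h12 h13 hφ
  · intro L1 L2 L3 _ _ _ g hg
    exact maslov_map_of_isSymplectic hg L1 L2 L3
  · intro L1 L2 L3 L4 h1 h2 h3 h4
    exact maslov_cocycle h1 h2 h3 h4
end
end

section
/- Let (L1, M1, L2, M2) be a positive quadruple of Lagrangians in (ℝ^{2n}, ω). Then: (1) there exists a symplectic basis (e, f) in standard position with respect to (L1, M1, L2, M2), and the diagonal matrix Λ ∈ Δ_n occurring in the definition of standard position is uniquely determined by the quadruple; (2) the symplectic bases in standard position with respect to (L1, M1, L2, M2) are exactly the pairs (e·h, f·h) for h ∈ O(n) commuting with Λ; (3) setting u := Λ^{1/2} (the diagonal matrix whose entries are the positive square roots of those of Λ), the pair (e', f') := (f·u, −e·u^{−1}) is a symplectic basis in standard position with respect to (L2, M2, L1, M1). -/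
open Matrix

noncomputable section

/-- `tmul v g` is the tuple `v·g`, with `(v·g)_j = Σ_i g_{ij} • v_i`. -/
def tmul (n : ℕ) (v : Fin n → V2 n) (g : Matrix (Fin n) (Fin n) ℝ) : Fin n → V2 n :=
  fun j => ∑ i, g i j • v i

/-- A symplectic basis of `ℝ^{2n}`: a pair of `n`-tuples forming a basis, with
`ω(e_i,e_j) = ω(f_i,f_j) = 0` and `ω(e_i,f_j) = δ_{ij}`. -/
def IsSymplecticBasis (n : ℕ) (e f : Fin n → V2 n) : Prop :=
  (∀ i j, omegaForm n (e i) (e j) = 0) ∧ (∀ i j, omegaForm n (f i) (f j) = 0) ∧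
  (∀ i j, omegaForm n (e i) (f j) = if i = j then 1 else 0) ∧
  LinearIndependent ℝ (Sum.elim e f) ∧
  Submodule.span ℝ (Set.range (Sum.elim e f)) = ⊤

/-- Membership in `Δ_n`: diagonal matrices with positive nondecreasing entries. -/
def InDelta (n : ℕ) (Λ : Matrix (Fin n) (Fin n) ℝ) : Prop :=
  ∃ d : Fin n → ℝ, Λ = Matrix.diagonal d ∧ (∀ i, 0 < d i) ∧ Monotone d

/-- A positive quadruple of Lagrangians: the triples `(L1,M1,L2)` and `(L1,M2,L2)` are
pairwise transverse, and the Maslov forms `[L1,M1,L2]` and `[L2,M2,L1]` are positive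
definite. -/
def PositiveQuadruple (n : ℕ) (L1 M1 L2 M2 : Submodule ℝ (V2 n)) : Prop :=
  IsLagrangian n L1 ∧ IsLagrangian n M1 ∧ IsLagrangian n L2 ∧ IsLagrangian n M2 ∧
  L1 ⊓ M1 = ⊥ ∧ M1 ⊓ L2 = ⊥ ∧ L1 ⊓ L2 = ⊥ ∧ L1 ⊓ M2 = ⊥ ∧ M2 ⊓ L2 = ⊥ ∧
  (∃ φ : L1 →ₗ[ℝ] L2, IsGraphMap n L1 M1 L2 φ ∧
    ∀ v : ↥L1, v ≠ 0 → 0 < omegaForm n (v : V2 n) (φ v : V2 n)) ∧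
  (∃ ψ : L2 →ₗ[ℝ] L1, IsGraphMap n L2 M2 L1 ψ ∧
    ∀ w : ↥L2, w ≠ 0 → 0 < omegaForm n (w : V2 n) (ψ w : V2 n))

/-- A symplectic basis `(e,f)` is in standard position with respect to `(L1,M1,L2,M2)`,
with invariant `Λ ∈ Δ_n`, if `L1 = Span e`, `L2 = Span f`, `M1 = Span (e+f)` and
`M2 = Span (e − f·Λ)`. -/
def StandardPosition (n : ℕ) (e f : Fin n → V2 n)
    (L1 M1 L2 M2 : Submodule ℝ (V2 n)) (Λ : Matrix (Fin n) (Fin n) ℝ) : Prop :=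
  IsSymplecticBasis n e f ∧ InDelta n Λ ∧
  L1 = Submodule.span ℝ (Set.range e) ∧
  L2 = Submodule.span ℝ (Set.range f) ∧
  M1 = Submodule.span ℝ (Set.range (e + f)) ∧
  M2 = Submodule.span ℝ (Set.range (e - tmul n f Λ))

theorem omegaForm_eq_toLinearMap₂' (n : ℕ) (x y : V2 n) :
    omegaForm n x y = Matrix.toLinearMap₂' ℝ (Jn n) x y := by
  rw [Matrix.toLinearMap₂'_apply', omegaForm]

theorem omegaForm_swap (n : ℕ) (x y : V2 n) : omegaForm n x y = -omegaForm n y x := by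
  have hJ : (Jn n)ᵀ = -Jn n := by
    simp [Jn, Matrix.fromBlocks_transpose, Matrix.fromBlocks_neg]
  rw [omegaForm, omegaForm, Matrix.dotProduct_mulVec, ← Matrix.mulVec_transpose, hJ,
    Matrix.neg_mulVec, neg_dotProduct, dotProduct_comm]

/-- The matrix of pairings `ω(v_i, w_j)` of two tuples. -/
def omegaGram (n : ℕ) (v w : Fin n → V2 n) : Matrix (Fin n) (Fin n) ℝ :=
  Matrix.of fun i j => omegaForm n (v i) (w j)

theorem omegaGram_add_left (n : ℕ) (v v' w : Fin n → V2 n) :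
    omegaGram n (v + v') w = omegaGram n v w + omegaGram n v' w := by
  ext i j; simp [omegaGram, omegaForm_eq_toLinearMap₂']

theorem omegaGram_sub_left (n : ℕ) (v v' w : Fin n → V2 n) :
    omegaGram n (v - v') w = omegaGram n v w - omegaGram n v' w := by
  ext i j; simp [omegaGram, omegaForm_eq_toLinearMap₂']

theorem omegaGram_neg_left (n : ℕ) (v w : Fin n → V2 n) :
    omegaGram n (-v) w = -omegaGram n v w := by
  ext i j; simp [omegaGram, omegaForm_eq_toLinearMap₂']

theorem omegaGram_neg_right (n : ℕ) (v w : Fin n → V2 n) :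
    omegaGram n v (-w) = -omegaGram n v w := by
  ext i j; simp [omegaGram, omegaForm_eq_toLinearMap₂']

theorem omegaGram_swap (n : ℕ) (v w : Fin n → V2 n) :
    omegaGram n v w = -(omegaGram n w v)ᵀ := by
  ext i j; simpa [omegaGram] using omegaForm_swap n (v i) (w j)

theorem omegaGram_tmul_left (n : ℕ) (v w : Fin n → V2 n) (g : Matrix (Fin n) (Fin n) ℝ) :
    omegaGram n (tmul n v g) w = gᵀ * omegaGram n v w := by
  ext i j
  simp [omegaGram, omegaForm_eq_toLinearMap₂', tmul, Matrix.mul_apply, LinearMap.sum_apply]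

theorem omegaGram_tmul_right (n : ℕ) (v w : Fin n → V2 n) (g : Matrix (Fin n) (Fin n) ℝ) :
    omegaGram n v (tmul n w g) = omegaGram n v w * g := by
  ext i j
  simp [omegaGram, omegaForm_eq_toLinearMap₂', tmul, Matrix.mul_apply, mul_comm]

theorem tmul_one (n : ℕ) (v : Fin n → V2 n) : tmul n v 1 = v := by
  funext j
  simp [tmul, Matrix.one_apply]

theorem tmul_tmul (n : ℕ) (v : Fin n → V2 n) (g h : Matrix (Fin n) (Fin n) ℝ) :
    tmul n (tmul n v g) h = tmul n v (g * h) := by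
  funext j
  simp only [tmul, Matrix.mul_apply, Finset.smul_sum, smul_smul, Finset.sum_smul]
  rw [Finset.sum_comm]
  simp only [mul_comm]

theorem tmul_add (n : ℕ) (v w : Fin n → V2 n) (g : Matrix (Fin n) (Fin n) ℝ) :
    tmul n (v + w) g = tmul n v g + tmul n w g := by
  funext j
  simp [tmul, Finset.sum_add_distrib]

theorem tmul_neg (n : ℕ) (v : Fin n → V2 n) (g : Matrix (Fin n) (Fin n) ℝ) :
    tmul n (-v) g = -tmul n v g := by
  funext j
  simp [tmul]

theorem tmul_sub (n : ℕ) (v w : Fin n → V2 n) (g : Matrix (Fin n) (Fin n) ℝ) :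
    tmul n (v - w) g = tmul n v g - tmul n w g := by
  rw [sub_eq_add_neg, tmul_add, tmul_neg, sub_eq_add_neg]

theorem tmul_diagonal (n : ℕ) (v : Fin n → V2 n) (d : Fin n → ℝ) (j : Fin n) :
    tmul n v (Matrix.diagonal d) j = d j • v j := by
  simp [tmul, Matrix.diagonal_apply]

theorem span_tmul_le (n : ℕ) (v : Fin n → V2 n) (g : Matrix (Fin n) (Fin n) ℝ) :
    Submodule.span ℝ (Set.range (tmul n v g)) ≤ Submodule.span ℝ (Set.range v) := by
  rw [Submodule.span_le]
  rintro _ ⟨j, rfl⟩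
  exact Submodule.sum_mem _ fun i _ =>
    Submodule.smul_mem _ _ (Submodule.subset_span ⟨i, rfl⟩)

theorem span_tmul_eq_of_mul_eq_one (n : ℕ) (v : Fin n → V2 n)
    {g g' : Matrix (Fin n) (Fin n) ℝ} (h : g * g' = 1) :
    Submodule.span ℝ (Set.range (tmul n v g)) = Submodule.span ℝ (Set.range v) := by
  refine le_antisymm (span_tmul_le n v g) ?_
  have := span_tmul_le n (tmul n v g) g'
  rwa [tmul_tmul, h, tmul_one] at this

theorem exists_eq_tmul_of_span_eq (n : ℕ) {v w : Fin n → V2 n}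
    (h : Submodule.span ℝ (Set.range w) = Submodule.span ℝ (Set.range v)) :
    ∃ g, w = tmul n v g := by
  have hmem : ∀ j, ∃ c : Fin n → ℝ, ∑ i, c i • v i = w j := fun j => by
    rw [← Submodule.mem_span_range_iff_exists_fun, ← h]
    exact Submodule.subset_span ⟨j, rfl⟩
  choose c hc using hmem
  exact ⟨Matrix.of fun i j => c j i, funext fun j => (hc j).symm⟩

theorem span_range_neg (n : ℕ) (v : Fin n → V2 n) :
    Submodule.span ℝ (Set.range (-v)) = Submodule.span ℝ (Set.range v) := by
  have h : -v = tmul n v (-1) := by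
    funext j
    simp [tmul, Matrix.one_apply]
  rw [h, span_tmul_eq_of_mul_eq_one n v (g' := -1) (by simp)]

/-- A tuple admitting an `ω`-dual tuple is linearly independent. -/
theorem linearIndependent_of_omegaGram_eq_one (n : ℕ) {v w : Fin n → V2 n}
    (h : omegaGram n v w = 1) : LinearIndependent ℝ v := by
  rw [Fintype.linearIndependent_iff]
  intro c hc j
  have h1 := congrArg (fun x => omegaForm n x (w j)) hc
  have h2 : ∀ i, omegaForm n (v i) (w j) = (1 : Matrix (Fin n) (Fin n) ℝ) i j := fun i => by
    rw [← h]; rfl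
  simp only [omegaForm_eq_toLinearMap₂'] at h1 h2
  simpa [LinearMap.sum_apply, h2, Matrix.one_apply] using h1

/-- A tuple in an `n`-dimensional subspace admitting an `ω`-dual tuple spans it. -/
theorem eq_span_range_of_omegaGram_eq_one (n : ℕ) {L : Submodule ℝ (V2 n)}
    (hL : Module.finrank ℝ L = n) {v w : Fin n → V2 n} (hv : ∀ i, v i ∈ L)
    (h : omegaGram n v w = 1) : L = Submodule.span ℝ (Set.range v) := by
  symm
  apply Submodule.eq_of_le_of_finrank_eq
  · rw [Submodule.span_le]
    rintro _ ⟨i, rfl⟩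
    exact hv i
  · rw [finrank_span_eq_card (linearIndependent_of_omegaGram_eq_one n h), hL, Fintype.card_fin]

/-- The pairing relations of a symplectic basis already imply that it is a basis. -/
theorem isSymplecticBasis_iff_omegaGram (n : ℕ) (e f : Fin n → V2 n) :
    IsSymplecticBasis n e f ↔
      omegaGram n e e = 0 ∧ omegaGram n f f = 0 ∧ omegaGram n e f = 1 := by
  constructor
  · rintro ⟨hee, hff, hef, -, -⟩
    refine ⟨Matrix.ext hee, Matrix.ext hff, Matrix.ext fun i j => ?_⟩
    simpa [omegaGram, Matrix.one_apply] using hef i j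
  · rintro ⟨hee, hff, hef⟩
    have hee' : ∀ i j, omegaForm n (e i) (e j) = 0 := fun i j => congrFun (congrFun hee i) j
    have hff' : ∀ i j, omegaForm n (f i) (f j) = 0 := fun i j => congrFun (congrFun hff i) j
    have hef' : ∀ i j, omegaForm n (e i) (f j) = if i = j then 1 else 0 := fun i j => by
      rw [← Matrix.one_apply, ← hef]; rfl
    have hli : LinearIndependent ℝ (Sum.elim e f) := by
      refine (linearIndependent_of_omegaGram_eq_one n hef).sum_type
        (linearIndependent_of_omegaGram_eq_one n (w := -e) ?_) ?_
      · rw [omegaGram_neg_right, omegaGram_swap, hef]; simp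
      · rw [Submodule.disjoint_def]
        intro x hxe hxf
        obtain ⟨c, rfl⟩ := (Submodule.mem_span_range_iff_exists_fun ℝ).1 hxe
        obtain ⟨c', hc'⟩ := (Submodule.mem_span_range_iff_exists_fun ℝ).1 hxf
        refine Finset.sum_eq_zero fun j _ => ?_
        have h := congrArg (fun x => omegaForm n x (f j)) hc'
        simp only [omegaForm_eq_toLinearMap₂'] at h hff' hef'
        have hcj : c j = 0 := by
          simpa [LinearMap.sum_apply, hff', hef'] using h.symm
        rw [hcj, zero_smul]
    refine ⟨hee', hff', hef', hli, ?_⟩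
    apply hli.span_eq_top_of_card_eq_finrank'
    simp

theorem tmul_add_tmul_inj (n : ℕ) {e f : Fin n → V2 n} (hb : IsSymplecticBasis n e f)
    {a b c d : Matrix (Fin n) (Fin n) ℝ}
    (h : tmul n e a + tmul n f b = tmul n e c + tmul n f d) : a = c ∧ b = d := by
  obtain ⟨hee, hff, hef⟩ := (isSymplecticBasis_iff_omegaGram n e f).1 hb
  have hfe : omegaGram n f e = -1 := by rw [omegaGram_swap, hef]; simp
  have h1 := congrArg (fun x => omegaGram n x f) h
  have h2 := congrArg (fun x => omegaGram n x e) h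
  simp only [omegaGram_add_left, omegaGram_tmul_left, hee, hff, hef, hfe] at h1 h2
  exact ⟨Matrix.transpose_injective (by simpa using h1),
    Matrix.transpose_injective (by simpa using h2)⟩

/-- Two bases in standard position differ by an orthogonal matrix intertwining the invariants. -/
theorem StandardPosition.exists_orthogonal {n : ℕ} {L1 M1 L2 M2 : Submodule ℝ (V2 n)}
    {e f e' f' : Fin n → V2 n} {Λ Λ' : Matrix (Fin n) (Fin n) ℝ}
    (H : StandardPosition n e f L1 M1 L2 M2 Λ) (H' : StandardPosition n e' f' L1 M1 L2 M2 Λ') :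
    ∃ h : Matrix (Fin n) (Fin n) ℝ, hᵀ * h = 1 ∧ h * Λ' = Λ * h ∧
      e' = tmul n e h ∧ f' = tmul n f h := by
  obtain ⟨hb, -, hL1, hL2, hM1, hM2⟩ := H
  obtain ⟨hb', -, hL1', hL2', hM1', hM2'⟩ := H'
  obtain ⟨h, rfl⟩ := exists_eq_tmul_of_span_eq n (hL1'.symm.trans hL1)
  obtain ⟨k, rfl⟩ := exists_eq_tmul_of_span_eq n (hL2'.symm.trans hL2)
  obtain ⟨m, hm⟩ := exists_eq_tmul_of_span_eq n (hM1'.symm.trans hM1)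
  obtain ⟨p, hp⟩ := exists_eq_tmul_of_span_eq n (hM2'.symm.trans hM2)
  rw [tmul_add] at hm
  obtain ⟨rfl, rfl⟩ := tmul_add_tmul_inj n hb hm
  rw [tmul_sub, tmul_tmul, tmul_tmul, sub_eq_add_neg, sub_eq_add_neg, ← tmul_neg,
    ← tmul_neg] at hp
  have hneg : ∀ g, tmul n (-f) g = tmul n f (-g) := fun g => by
    rw [tmul_neg]
    funext j
    simp [tmul]
  rw [hneg, hneg] at hp
  obtain ⟨rfl, hΛ⟩ := tmul_add_tmul_inj n hb hp
  refine ⟨_, ?_, by simpa using hΛ, rfl, rfl⟩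
  have := ((isSymplecticBasis_iff_omegaGram n _ _).1 hb').2.2
  rwa [omegaGram_tmul_left, omegaGram_tmul_right,
    ((isSymplecticBasis_iff_omegaGram n _ _).1 hb).2.2, one_mul] at this

/-- Similar diagonal matrices with nondecreasing entries are equal. -/
theorem diagonal_eq_of_mul_eq_mul {n : ℕ} {d d' : Fin n → ℝ} (hd : Monotone d)
    (hd' : Monotone d') {h g : Matrix (Fin n) (Fin n) ℝ} (hg : g * h = 1)
    (hc : h * Matrix.diagonal d' = Matrix.diagonal d * h) :
    Matrix.diagonal d' = Matrix.diagonal d := by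
  have hg' : h * g = 1 := mul_eq_one_comm.1 hg
  let u : (Matrix (Fin n) (Fin n) ℝ)ˣ := ⟨h, g, hg', hg⟩
  have hconj : h * Matrix.diagonal d' * g = Matrix.diagonal d := by
    rw [hc, mul_assoc, hg', mul_one]
  have hchar := Matrix.charpoly_units_conj u (Matrix.diagonal d')
  rw [Matrix.inv_eq_left_inv (show g * (u : Matrix (Fin n) (Fin n) ℝ) = 1 from hg)] at hchar
  change (h * Matrix.diagonal d' * g).charpoly = _ at hchar
  rw [hconj, Matrix.charpoly_diagonal, Matrix.charpoly_diagonal] at hchar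
  have hroots : ∀ c : Fin n → ℝ,
      (∏ i, (Polynomial.X - Polynomial.C (c i))).roots = (List.ofFn c : Multiset ℝ) := fun c => by
    have hmap := Polynomial.roots_multiset_prod_X_sub_C (Multiset.map c Finset.univ.val)
    rw [Multiset.map_map] at hmap
    rw [← Fin.univ_val_map]
    exact hmap
  have hperm := congrArg Polynomial.roots hchar
  rw [hroots, hroots, Multiset.coe_eq_coe] at hperm
  rw [List.ofFn_injective (hperm.eq_of_sortedLE hd.sortedLE_ofFn hd'.sortedLE_ofFn)]

/-- Spectral theorem for an operator that is self-adjoint with respect to a positive definite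
symmetric bilinear form, with the eigenvalues in nonincreasing order. -/
theorem exists_orthonormal_eigenvectors {E : Type*} [AddCommGroup E] [Module ℝ E]
    [FiniteDimensional ℝ E] {n : ℕ} (hn : Module.finrank ℝ E = n) (β : E →ₗ[ℝ] E →ₗ[ℝ] ℝ)
    (hsymm : ∀ v w, β v w = β w v) (hpos : ∀ v, v ≠ 0 → 0 < β v v) (T : E →ₗ[ℝ] E)
    (hT : ∀ v w, β (T v) w = β v (T w)) :
    ∃ (b : Fin n → E) (μ : Fin n → ℝ), (∀ i j, β (b i) (b j) = if i = j then 1 else 0) ∧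
      (∀ i, T (b i) = μ i • b i) ∧ Antitone μ := by
  let core : InnerProductSpace.Core ℝ E :=
    { inner := fun v w => β v w
      conj_inner_symm := fun v w => hsymm w v
      re_inner_nonneg := fun v => by
        rcases eq_or_ne v 0 with rfl | hv
        · simp
        · exact (hpos v hv).le
      add_left := fun u v w => by simp
      smul_left := fun v w r => by simp
      definite := fun v hv => by
        by_contra hne
        exact (hpos v hne).ne' hv }
  let _ : NormedAddCommGroup E := core.toNormedAddCommGroup
  let _ : InnerProductSpace ℝ E := InnerProductSpace.ofCore core.toCore
  have hT' : T.IsSymmetric := hT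
  refine ⟨hT'.eigenvectorBasis hn, hT'.eigenvalues hn, fun i j => ?_, fun i => ?_,
    hT'.eigenvalues_antitone hn⟩
  · exact orthonormal_iff_ite.1 (hT'.eigenvectorBasis hn).orthonormal i j
  · exact hT'.apply_eigenvectorBasis hn i

/-- A Lagrangian that is a graph over another one has a symmetric Maslov form. -/
theorem IsGraphMap.omegaForm_symm {n : ℕ} {L M L' : Submodule ℝ (V2 n)} {φ : L →ₗ[ℝ] L'}
    (hφ : IsGraphMap n L M L' φ) (hL : IsLagrangian n L) (hM : IsLagrangian n M)
    (hL' : IsLagrangian n L') (v w : L) :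
    omegaForm n (v : V2 n) (φ w : V2 n) = omegaForm n (w : V2 n) (φ v : V2 n) := by
  have h := hM.2 _ ((hφ _).2 ⟨v, rfl⟩) _ ((hφ _).2 ⟨w, rfl⟩)
  have h1 := hL.2 _ v.2 _ w.2
  have h2 := hL'.2 _ (φ v).2 _ (φ w).2
  rw [omegaForm_swap n w]
  simp only [omegaForm_eq_toLinearMap₂', map_add, LinearMap.add_apply] at h h1 h2 ⊢
  linarith

theorem PositiveQuadruple.exists_standardPosition {n : ℕ} {L1 M1 L2 M2 : Submodule ℝ (V2 n)}
    (hpos : PositiveQuadruple n L1 M1 L2 M2) :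
    ∃ e f Λ, StandardPosition n e f L1 M1 L2 M2 Λ := by
  obtain ⟨hL1, hM1, hL2, hM2, -, -, -, -, -, ⟨φ, hφ, hφpos⟩, ⟨ψ, hψ, hψpos⟩⟩ := hpos
  let β : L1 →ₗ[ℝ] L1 →ₗ[ℝ] ℝ :=
    (Matrix.toLinearMap₂' ℝ (Jn n)).compl₁₂ L1.subtype (L2.subtype ∘ₗ φ)
  have hβ : ∀ v w, β v w = omegaForm n (v : V2 n) (φ w : V2 n) := fun v w => by
    rw [omegaForm_eq_toLinearMap₂']; rfl
  have hβsymm : ∀ v w, β v w = β w v := fun v w => by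
    rw [hβ, hβ, hφ.omegaForm_symm hL1 hM1 hL2]
  have hT : ∀ v w, β (-(ψ (φ v))) w = omegaForm n (φ w : V2 n) (ψ (φ v) : V2 n) := fun v w => by
    rw [map_neg, LinearMap.neg_apply, hβ, ← omegaForm_swap]
  obtain ⟨b, μ, hb, hμ, hanti⟩ := exists_orthonormal_eigenvectors hL1.1 β hβsymm
    (fun v hv => by rw [hβ]; exact hφpos v hv) (-(ψ ∘ₗ φ)) (fun v w => by
      rw [hβsymm v]
      simp only [LinearMap.neg_apply, LinearMap.comp_apply]
      rw [hT, hT, hψ.omegaForm_symm hL2 hM2 hL1])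
  have hψφ : ∀ i, ψ (φ (b i)) = -(μ i • b i) := fun i => by
    rw [← hμ i]; simp
  have hμpos : ∀ i, 0 < μ i := fun i => by
    have hne : φ (b i) ≠ 0 := fun h0 => by
      have h1 := hb i i
      rw [hβ, h0, omegaForm_eq_toLinearMap₂'] at h1
      simp at h1
    have h1 := hψpos _ hne
    rw [← hT, hψφ, neg_neg, map_smul, LinearMap.smul_apply, hb] at h1
    simpa using h1
  have hee : omegaGram n (fun i => (b i : V2 n)) (fun i => (b i : V2 n)) = 0 :=
    Matrix.ext fun i j => hL1.2 _ (b i).2 _ (b j).2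
  have hff : omegaGram n (fun i => (φ (b i) : V2 n)) (fun i => (φ (b i) : V2 n)) = 0 :=
    Matrix.ext fun i j => hL2.2 _ (φ (b i)).2 _ (φ (b j)).2
  have hef : omegaGram n (fun i => (b i : V2 n)) (fun i => (φ (b i) : V2 n)) = 1 :=
    Matrix.ext fun i j => by
      rw [Matrix.one_apply, ← hb i j, hβ]; rfl
  refine ⟨fun i => b i, fun i => φ (b i), Matrix.diagonal fun i => (μ i)⁻¹,
    (isSymplecticBasis_iff_omegaGram n _ _).2 ⟨hee, hff, hef⟩,
    ⟨_, rfl, fun i => inv_pos.2 (hμpos i), fun i j hij => inv_anti₀ (hμpos j) (hanti hij)⟩,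
    eq_span_range_of_omegaGram_eq_one n hL1.1 (fun i => (b i).2) hef,
    eq_span_range_of_omegaGram_eq_one n hL2.1 (w := -fun i => (b i : V2 n))
      (fun i => (φ (b i)).2) ?_,
    eq_span_range_of_omegaGram_eq_one n hM1.1 (w := fun i => (φ (b i) : V2 n))
      (fun i => (hφ _).2 ⟨b i, rfl⟩) ?_,
    eq_span_range_of_omegaGram_eq_one n hM2.1 (w := fun i => (φ (b i) : V2 n))
      (fun i => ?_) ?_⟩
  · rw [omegaGram_neg_right, omegaGram_swap, hef]; simp
  · rw [omegaGram_add_left, hef, hff, add_zero]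
  · refine (hψ _).2 ⟨-((μ i)⁻¹ • φ (b i)), ?_⟩
    rw [map_neg, map_smul, hψφ, Pi.sub_apply, tmul_diagonal, smul_neg, neg_neg, smul_smul,
      inv_mul_cancel₀ (hμpos i).ne', one_smul, Submodule.coe_neg, Submodule.coe_smul]
    abel
  · rw [omegaGram_sub_left, omegaGram_tmul_left, hef, hff, mul_zero, sub_zero]

theorem StandardPosition.tmul_orthogonal {n : ℕ} {L1 M1 L2 M2 : Submodule ℝ (V2 n)}
    {e f : Fin n → V2 n} {Λ h : Matrix (Fin n) (Fin n) ℝ}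
    (H : StandardPosition n e f L1 M1 L2 M2 Λ) (hh : hᵀ * h = 1) (hΛ : h * Λ = Λ * h) :
    StandardPosition n (tmul n e h) (tmul n f h) L1 M1 L2 M2 Λ := by
  obtain ⟨hb, hΔ, hL1, hL2, hM1, hM2⟩ := H
  obtain ⟨hee, hff, hef⟩ := (isSymplecticBasis_iff_omegaGram n e f).1 hb
  have hh' : h * hᵀ = 1 := mul_eq_one_comm.1 hh
  refine ⟨(isSymplecticBasis_iff_omegaGram n _ _).2 ⟨?_, ?_, ?_⟩, hΔ, ?_, ?_, ?_, ?_⟩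
  · simp [omegaGram_tmul_left, omegaGram_tmul_right, hee]
  · simp [omegaGram_tmul_left, omegaGram_tmul_right, hff]
  · simp [omegaGram_tmul_left, omegaGram_tmul_right, hef, hh]
  · rw [span_tmul_eq_of_mul_eq_one n e hh', hL1]
  · rw [span_tmul_eq_of_mul_eq_one n f hh', hL2]
  · rw [← tmul_add, span_tmul_eq_of_mul_eq_one n _ hh', hM1]
  · rw [tmul_tmul, hΛ, ← tmul_tmul, ← tmul_sub, span_tmul_eq_of_mul_eq_one n _ hh', hM2]

theorem StandardPosition.rotate {n : ℕ} {L1 M1 L2 M2 : Submodule ℝ (V2 n)}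
    {e f : Fin n → V2 n} {d : Fin n → ℝ}
    (H : StandardPosition n e f L1 M1 L2 M2 (Matrix.diagonal d)) :
    StandardPosition n (tmul n f (Matrix.diagonal fun i => Real.sqrt (d i)))
      (-(tmul n e (Matrix.diagonal fun i => (Real.sqrt (d i))⁻¹))) L2 M2 L1 M1
      (Matrix.diagonal d) := by
  obtain ⟨hb, hΔ, hL1, hL2, hM1, hM2⟩ := H
  obtain ⟨hee, hff, hef⟩ := (isSymplecticBasis_iff_omegaGram n e f).1 hb
  have hfe : omegaGram n f e = -1 := by rw [omegaGram_swap, hef]; simp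
  have hd : ∀ i, 0 < d i := by
    obtain ⟨d', hd', hd'pos, -⟩ := hΔ
    rwa [Matrix.diagonal_injective hd']
  have hs : ∀ i, Real.sqrt (d i) ≠ 0 := fun i => (Real.sqrt_pos.2 (hd i)).ne'
  set u : Matrix (Fin n) (Fin n) ℝ := Matrix.diagonal fun i => Real.sqrt (d i) with hu
  set u' : Matrix (Fin n) (Fin n) ℝ := Matrix.diagonal fun i => (Real.sqrt (d i))⁻¹ with hu'
  have huu' : u * u' = 1 := by
    rw [hu, hu', Matrix.diagonal_mul_diagonal]; simp [hs]
  have hu'u : u' * u = 1 := mul_eq_one_comm.1 huu'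
  have hdu : Matrix.diagonal d * u' = u := by
    rw [hu, hu', Matrix.diagonal_mul_diagonal]
    congr 1; funext i
    rw [← div_eq_mul_inv, Real.div_sqrt]
  have hud : u' * Matrix.diagonal d = u := by
    rw [← hdu, hu', Matrix.diagonal_mul_diagonal, Matrix.diagonal_mul_diagonal]
    simp only [mul_comm]
  have hut : uᵀ = u := Matrix.diagonal_transpose _
  refine ⟨(isSymplecticBasis_iff_omegaGram n _ _).2 ⟨?_, ?_, ?_⟩, hΔ, ?_, ?_, ?_, ?_⟩
  · simp [omegaGram_tmul_left, omegaGram_tmul_right, hff]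
  · simp [omegaGram_neg_left, omegaGram_neg_right, omegaGram_tmul_left, omegaGram_tmul_right, hee]
  · simp [omegaGram_neg_right, omegaGram_tmul_left, omegaGram_tmul_right, hfe, hut, huu']
  · rw [span_tmul_eq_of_mul_eq_one n f huu', hL2]
  · rw [span_range_neg, span_tmul_eq_of_mul_eq_one n e hu'u, hL1]
  · have h : tmul n f u + -tmul n e u' = -tmul n (e - tmul n f (Matrix.diagonal d)) u' := by
      rw [tmul_sub, tmul_tmul, hdu]; abel
    rw [h, span_range_neg, span_tmul_eq_of_mul_eq_one n _ hu'u, hM2]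
  · have h : tmul n f u - tmul n (-tmul n e u') (Matrix.diagonal d) = tmul n (e + f) u := by
      rw [tmul_neg, tmul_tmul, hud, tmul_add]; abel
    rw [h, span_tmul_eq_of_mul_eq_one n _ huu', hM1]

theorem positive_quadruple_standard_basis (n : ℕ) (L1 M1 L2 M2 : Submodule ℝ (V2 n))
    (hpos : PositiveQuadruple n L1 M1 L2 M2) :
    -- (1) existence of a basis in standard position, and uniqueness of the invariant `Λ`
    (∃ e f Λ, StandardPosition n e f L1 M1 L2 M2 Λ) ∧
    (∀ e f Λ e' f' Λ', StandardPosition n e f L1 M1 L2 M2 Λ →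
      StandardPosition n e' f' L1 M1 L2 M2 Λ' → Λ' = Λ) ∧
    -- (2) the bases in standard position are exactly the `(e·h, f·h)` for `h ∈ O(n)`
    -- commuting with `Λ`
    (∀ e f Λ, StandardPosition n e f L1 M1 L2 M2 Λ →
      ∀ e' f' : Fin n → V2 n,
        (∃ Λ', StandardPosition n e' f' L1 M1 L2 M2 Λ') ↔
          ∃ h : Matrix (Fin n) (Fin n) ℝ, hᵀ * h = 1 ∧ h * Λ = Λ * h ∧
            e' = tmul n e h ∧ f' = tmul n f h) ∧
    -- (3) with `u = Λ^{1/2}`, the basis `(f·u, −e·u⁻¹)` is in standard position with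
    -- respect to `(L2, M2, L1, M1)`
    (∀ e f Λ (d : Fin n → ℝ), StandardPosition n e f L1 M1 L2 M2 Λ →
      Λ = Matrix.diagonal d →
      ∃ Λ₂, StandardPosition n
        (tmul n f (Matrix.diagonal fun i => Real.sqrt (d i)))
        (-(tmul n e (Matrix.diagonal fun i => (Real.sqrt (d i))⁻¹)))
        L2 M2 L1 M1 Λ₂) := by
  refine ⟨hpos.exists_standardPosition, ?_, ?_, ?_⟩
  · intro e f Λ e' f' Λ' H H'
    obtain ⟨h, hh, hc, -, -⟩ := H.exists_orthogonal H'
    obtain ⟨d, rfl, -, hd⟩ := H.2.1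
    obtain ⟨d', rfl, -, hd'⟩ := H'.2.1
    exact diagonal_eq_of_mul_eq_mul hd hd' hh hc
  · intro e f Λ H e' f'
    constructor
    · rintro ⟨Λ', H'⟩
      obtain ⟨h, hh, hc, he, hf⟩ := H.exists_orthogonal H'
      obtain ⟨d, rfl, -, hd⟩ := H.2.1
      obtain ⟨d', rfl, -, hd'⟩ := H'.2.1
      rw [diagonal_eq_of_mul_eq_mul hd hd' hh hc] at hc
      exact ⟨h, hh, hc, he, hf⟩
    · rintro ⟨h, hh, hc, rfl, rfl⟩
      exact ⟨Λ, H.tmul_orthogonal hh hc⟩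
  · rintro e f _ d H rfl
    exact ⟨_, H.rotate⟩
end
end
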